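/- Let γ ∈ (0,1) and λ > 0, and define r_λ(t) = −(d/dt) E_γ(−λ Γ(γ) t^γ) for t > 0, where E_γ(z) = ∑_{n=0}^∞ zⁿ/Γ(nγ+1). Then r_λ is locally integrable on [0,∞) and for every t > 0: (a) r_λ(t) + λ ∫₀ᵗ (t−s)^(γ−1) r_λ(s) ds = λ t^(γ−1) (i.e., r_λ is the resolvent of the kernel λ t^(γ−1)); and (b) 1 − ∫₀ᵗ r_λ(s) ds = E_γ(−λ Γ(γ) t^γ). -/

import Mathlib

open MeasureTheory Set Filter

/-- The Mittag-Leffler function `E_γ(z) = ∑_{n=0}^∞ zⁿ/Γ(nγ+1)`. -/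
noncomputable def mittagLeffler (γ : ℝ) (z : ℝ) : ℝ :=
  ∑' n : ℕ, z ^ n / Real.Gamma ((n : ℝ) * γ + 1)

/-- The resolvent kernel `r_λ(t) = −(d/dt) E_γ(−λ Γ(γ) t^γ)` of the kernel `λ t^(γ−1)`. -/
noncomputable def resolventKernel (γ lam : ℝ) (t : ℝ) : ℝ :=
  -deriv (fun s : ℝ => mittagLeffler γ (-(lam * Real.Gamma γ) * s ^ γ)) t

/-- A lower bound for the Gamma function beating every exponential. -/
theorem rpow_mul_exp_neg_le_Gamma {R s : ℝ} (hR : 0 < R) (hs : 1 ≤ s) :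
    R ^ (s - 1) * Real.exp (-R) ≤ Real.Gamma s := by
  have hint := Real.GammaIntegral_convergent (zero_lt_one.trans_le hs)
  have hsub : Ioi R ⊆ Ioi 0 := Ioi_subset_Ioi hR.le
  rw [Real.Gamma_eq_integral (zero_lt_one.trans_le hs)]
  calc R ^ (s - 1) * Real.exp (-R)
      = ∫ x in Ioi R, R ^ (s - 1) * Real.exp (-x) := by
        rw [integral_const_mul, integral_exp_neg_Ioi]
    _ ≤ ∫ x in Ioi R, Real.exp (-x) * x ^ (s - 1) := by
        refine setIntegral_mono_on ((integrableOn_exp_neg_Ioi R).const_mul _)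
          (hint.mono_set hsub) measurableSet_Ioi fun x hx => ?_
        rw [mul_comm]
        have hRx : R ≤ x := le_of_lt hx
        gcongr
    _ ≤ ∫ x in Ioi 0, Real.exp (-x) * x ^ (s - 1) := by
        refine setIntegral_mono_set hint ?_ hsub.eventuallyLE
        filter_upwards [ae_restrict_mem measurableSet_Ioi] with x hx
        have : (0 : ℝ) < x := hx
        positivity

theorem summable_pow_div_Gamma {γ : ℝ} (hγ : 0 < γ) (δ x : ℝ) :
    Summable fun n : ℕ => x ^ n / Real.Gamma (n * γ + δ) := by
  set R : ℝ := (2 * (|x| + 1)) ^ (1 / γ) with hRdef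
  have hR : 0 < R := by positivity
  have hRγ : R ^ γ = 2 * (|x| + 1) := by
    rw [hRdef, ← Real.rpow_mul (by positivity), one_div_mul_cancel hγ.ne', Real.rpow_one]
  have hratio : |x| / (2 * (|x| + 1)) < 1 := by
    rw [div_lt_one (by positivity)]
    linarith [abs_nonneg x]
  refine Summable.of_norm_bounded_eventually_nat
    (g := fun n : ℕ => (R ^ (δ - 1) * Real.exp (-R))⁻¹ * (|x| / (2 * (|x| + 1))) ^ n)
    ((summable_geometric_of_lt_one (by positivity) hratio).mul_left _) ?_
  have hlim : Tendsto (fun n : ℕ => (n : ℝ) * γ + δ) atTop atTop :=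
    tendsto_atTop_add_const_right _ _ (tendsto_natCast_atTop_atTop.atTop_mul_const hγ)
  filter_upwards [hlim.eventually_ge_atTop 1] with n hn
  have hG : 0 < Real.Gamma (n * γ + δ) := Real.Gamma_pos_of_pos (zero_lt_one.trans_le hn)
  have hle := rpow_mul_exp_neg_le_Gamma hR hn
  have hpow : R ^ ((n : ℝ) * γ + δ - 1) = (2 * (|x| + 1)) ^ n * R ^ (δ - 1) := by
    rw [← hRγ, ← Real.rpow_natCast, ← Real.rpow_mul hR.le, ← Real.rpow_add hR]
    ring_nf
  rw [norm_div, norm_pow, Real.norm_eq_abs, Real.norm_of_nonneg hG.le]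
  calc |x| ^ n / Real.Gamma (n * γ + δ)
      ≤ |x| ^ n / (R ^ ((n : ℝ) * γ + δ - 1) * Real.exp (-R)) := by gcongr
    _ = _ := by
      rw [hpow, div_pow]
      field_simp

/-- The two-parameter Mittag-Leffler function `E_{γ,δ}(z) = ∑_{n=0}^∞ zⁿ/Γ(nγ+δ)`. -/
noncomputable def mittagLefflerTwo (γ δ z : ℝ) : ℝ :=
  ∑' n : ℕ, z ^ n / Real.Gamma (n * γ + δ)

theorem continuous_mittagLefflerTwo {γ : ℝ} (hγ : 0 < γ) (δ : ℝ) :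
    Continuous (mittagLefflerTwo γ δ) := by
  rw [continuous_iff_continuousAt]
  intro z
  have hcont : ContinuousOn (mittagLefflerTwo γ δ) (Metric.closedBall 0 (|z| + 1)) := by
    refine continuousOn_tsum (fun n => by fun_prop)
      (summable_pow_div_Gamma hγ δ (|z| + 1)).norm fun n x hx => ?_
    rw [mem_closedBall_zero_iff] at hx
    rw [norm_div, norm_div, norm_pow, norm_pow]
    gcongr
    exact hx.trans (le_abs_self _)
  refine hcont.continuousAt (Metric.closedBall_mem_nhds_of_mem ?_)
  rw [mem_ball_zero_iff, Real.norm_eq_abs]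
  linarith

theorem mittagLefflerTwo_eq_add {γ : ℝ} (hγ : 0 < γ) (δ z : ℝ) :
    mittagLefflerTwo γ δ z = 1 / Real.Gamma δ + z * mittagLefflerTwo γ (γ + δ) z := by
  rw [mittagLefflerTwo, (summable_pow_div_Gamma hγ δ z).tsum_eq_zero_add, mittagLefflerTwo,
    ← tsum_mul_left]
  congr 1
  · simp
  · refine tsum_congr fun n => ?_
    rw [pow_succ', mul_div_assoc]
    push_cast
    rw [show ((n : ℝ) + 1) * γ + δ = n * γ + (γ + δ) by ring]

theorem integral_sub_rpow_mul_rpow {β δ t : ℝ} (hβ : 0 < β) (hδ : 0 < δ) (ht : 0 < t) :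
    ∫ s in (0 : ℝ)..t, (t - s) ^ (β - 1) * s ^ (δ - 1) =
      Real.Gamma β * Real.Gamma δ / Real.Gamma (β + δ) * t ^ (β + δ - 1) := by
  have h := Complex.betaIntegral_scaled (δ : ℂ) (β : ℂ) ht
  rw [Complex.betaIntegral_eq_Gamma_mul_div _ _ (by simpa) (by simpa)] at h
  have hcongr : ∫ x in (0 : ℝ)..t, (x : ℂ) ^ ((δ : ℂ) - 1) * ((t : ℂ) - x) ^ ((β : ℂ) - 1) =
      ∫ x in (0 : ℝ)..t, (((t - x) ^ (β - 1) * x ^ (δ - 1) : ℝ) : ℂ) := by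
    refine intervalIntegral.integral_congr fun x hx => ?_
    rw [uIcc_of_le ht.le] at hx
    rw [Complex.ofReal_mul, Complex.ofReal_cpow (sub_nonneg.2 hx.2), Complex.ofReal_cpow hx.1]
    push_cast
    ring
  rw [hcongr, intervalIntegral.integral_ofReal, ← Complex.ofReal_add, Complex.Gamma_ofReal,
    Complex.Gamma_ofReal, Complex.Gamma_ofReal, ← Complex.ofReal_one, ← Complex.ofReal_sub,
    ← Complex.ofReal_cpow ht.le] at h
  have h' : ∫ s in (0 : ℝ)..t, (t - s) ^ (β - 1) * s ^ (δ - 1) =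
      t ^ (δ + β - 1) * (Real.Gamma δ * Real.Gamma β / Real.Gamma (δ + β)) := by
    exact_mod_cast h
  rw [h', add_comm δ β]
  ring

theorem intervalIntegrable_sub_rpow_mul_rpow {β δ t : ℝ} (hβ : 0 < β) (hδ : 0 < δ)
    (ht : 0 < t) :
    IntervalIntegrable (fun s : ℝ => (t - s) ^ (β - 1) * s ^ (δ - 1)) volume 0 t := by
  refine intervalIntegral.intervalIntegrable_of_integral_ne_zero ?_
  rw [integral_sub_rpow_mul_rpow hβ hδ ht]
  have := Real.Gamma_pos_of_pos hβ
  have := Real.Gamma_pos_of_pos hδ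
  have := Real.Gamma_pos_of_pos (add_pos hβ hδ)
  positivity

/-- The fractional integral of order `β` of `s ^ (δ - 1) * E_{γ,δ}(x s^γ)`. -/
theorem integral_sub_rpow_mul_mittagLefflerTwo {β γ δ t : ℝ} (hβ : 0 < β) (hγ : 0 < γ)
    (hδ : 0 < δ) (x : ℝ) (ht : 0 < t) :
    ∫ s in (0 : ℝ)..t, (t - s) ^ (β - 1) * (s ^ (δ - 1) * mittagLefflerTwo γ δ (x * s ^ γ)) =
      Real.Gamma β * t ^ (β + δ - 1) * mittagLefflerTwo γ (β + δ) (x * t ^ γ) := by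
  have hpos (n : ℕ) : 0 < (n : ℝ) * γ + δ := by positivity
  let f (n : ℕ) (s : ℝ) : ℝ := (t - s) ^ (β - 1) * s ^ ((n : ℝ) * γ + δ - 1)
  let F (n : ℕ) (s : ℝ) : ℝ := x ^ n / Real.Gamma (n * γ + δ) * f n s
  have hFint (n : ℕ) : IntegrableOn (F n) (Ioc 0 t) :=
    ((intervalIntegrable_iff_integrableOn_Ioc_of_le ht.le).1
      (intervalIntegrable_sub_rpow_mul_rpow hβ (hpos n) ht)).const_mul _
  have hf (n : ℕ) (y : ℝ) :
      ∫ s in Ioc 0 t, y ^ n / Real.Gamma (n * γ + δ) * f n s =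
        Real.Gamma β * t ^ (β + δ - 1) * ((y * t ^ γ) ^ n / Real.Gamma (n * γ + (β + δ))) := by
    rw [integral_const_mul, ← intervalIntegral.integral_of_le ht.le,
      integral_sub_rpow_mul_rpow hβ (hpos n) ht, mul_pow, ← Real.rpow_natCast (t ^ γ),
      ← Real.rpow_mul ht.le, show β + ((n : ℝ) * γ + δ) = n * γ + (β + δ) by ring,
      show (n : ℝ) * γ + (β + δ) - 1 = (β + δ - 1) + γ * n by ring, Real.rpow_add ht]
    have := (Real.Gamma_pos_of_pos (hpos n)).ne'
    field_simp
  have hnorm (n : ℕ) : ∫ s in Ioc 0 t, ‖F n s‖ =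
      Real.Gamma β * t ^ (β + δ - 1) * ((|x| * t ^ γ) ^ n / Real.Gamma (n * γ + (β + δ))) := by
    rw [← hf]
    refine setIntegral_congr_fun measurableSet_Ioc fun s hs => ?_
    have hfs : 0 ≤ f n s :=
      mul_nonneg (Real.rpow_nonneg (sub_nonneg.2 hs.2) _) (Real.rpow_nonneg hs.1.le _)
    simp only [F]
    rw [norm_mul, norm_div, norm_pow, Real.norm_of_nonneg hfs, Real.norm_eq_abs,
      Real.norm_of_nonneg (Real.Gamma_pos_of_pos (hpos n)).le]
  have hsum := hasSum_integral_of_summable_integral_norm hFint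
    (by simpa only [hnorm] using (summable_pow_div_Gamma hγ (β + δ) _).mul_left _)
  rw [intervalIntegral.integral_of_le ht.le, mittagLefflerTwo, ← tsum_mul_left]
  simp only [F, hf] at hsum
  rw [hsum.tsum_eq]
  refine setIntegral_congr_fun measurableSet_Ioc fun s hs => ?_
  simp only [mittagLefflerTwo]
  rw [← mul_assoc, ← tsum_mul_left]
  refine tsum_congr fun n => ?_
  simp only [f]
  rw [mul_pow, ← Real.rpow_natCast (s ^ γ), ← Real.rpow_mul hs.1.le,
    show (n : ℝ) * γ + δ - 1 = (δ - 1) + γ * n by ring, Real.rpow_add hs.1]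
  ring

theorem intervalIntegrable_rpow_mul_mittagLefflerTwo {γ δ : ℝ} (hγ : 0 < γ) (hδ : 0 < δ)
    (x a b : ℝ) :
    IntervalIntegrable (fun s : ℝ => s ^ (δ - 1) * mittagLefflerTwo γ δ (x * s ^ γ))
      volume a b :=
  (intervalIntegral.intervalIntegrable_rpow' (by linarith)).mul_continuousOn
    ((continuous_mittagLefflerTwo hγ δ).comp
      (continuous_const.mul (Real.continuous_rpow_const hγ.le))).continuousOn

/-- The antiderivative of `s ^ (γ - 1) * E_{γ,γ}(x s^γ)` in terms of `E_γ`. -/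
theorem mul_integral_rpow_mul_mittagLefflerTwo {γ t : ℝ} (hγ : 0 < γ) (x : ℝ) (ht : 0 < t) :
    x * ∫ s in (0 : ℝ)..t, s ^ (γ - 1) * mittagLefflerTwo γ γ (x * s ^ γ) =
      mittagLeffler γ (x * t ^ γ) - 1 := by
  have h := integral_sub_rpow_mul_mittagLefflerTwo one_pos hγ hγ x ht
  simp only [sub_self, Real.rpow_zero, one_mul, Real.Gamma_one, add_sub_cancel_left] at h
  have hE : mittagLeffler γ (x * t ^ γ) = mittagLefflerTwo γ 1 (x * t ^ γ) := rfl
  rw [h, hE, mittagLefflerTwo_eq_add hγ 1, Real.Gamma_one, add_comm γ 1]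
  ring

theorem hasDerivAt_mittagLeffler_mul_rpow {γ t : ℝ} (hγ : 0 < γ) (x : ℝ) (ht : 0 < t) :
    HasDerivAt (fun s : ℝ => mittagLeffler γ (x * s ^ γ))
      (x * (t ^ (γ - 1) * mittagLefflerTwo γ γ (x * t ^ γ))) t := by
  have hcont : ContinuousOn (fun s : ℝ => s ^ (γ - 1) * mittagLefflerTwo γ γ (x * s ^ γ))
      (Ioi 0) :=
    (continuousOn_id.rpow_const fun s hs => Or.inl (ne_of_gt hs)).mul
      ((continuous_mittagLefflerTwo hγ γ).comp
        (continuous_const.mul (Real.continuous_rpow_const hγ.le))).continuousOn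
  have hderiv := intervalIntegral.integral_hasDerivAt_right
    (intervalIntegrable_rpow_mul_mittagLefflerTwo hγ hγ x 0 t)
    (hcont.stronglyMeasurableAtFilter isOpen_Ioi t ht)
    (hcont.continuousAt (Ioi_mem_nhds ht))
  refine ((hderiv.const_mul x).add_const 1).congr_of_eventuallyEq ?_
  filter_upwards [Ioi_mem_nhds ht] with s hs
  rw [mul_integral_rpow_mul_mittagLefflerTwo hγ x hs, sub_add_cancel]

theorem resolventKernel_eq {γ t : ℝ} (hγ : 0 < γ) (lam : ℝ) (ht : 0 < t) :
    resolventKernel γ lam t = lam * Real.Gamma γ *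
      (t ^ (γ - 1) * mittagLefflerTwo γ γ (-(lam * Real.Gamma γ) * t ^ γ)) := by
  rw [resolventKernel, (hasDerivAt_mittagLeffler_mul_rpow hγ _ ht).deriv]
  ring

theorem integrableOn_resolventKernel {γ : ℝ} (hγ : 0 < γ) (lam : ℝ) {t : ℝ} (ht : 0 < t) :
    IntegrableOn (resolventKernel γ lam) (Ioc 0 t) := by
  have h := (intervalIntegrable_rpow_mul_mittagLefflerTwo hγ hγ (-(lam * Real.Gamma γ)) 0
    t).const_mul (lam * Real.Gamma γ)
  rw [intervalIntegrable_iff_integrableOn_Ioc_of_le ht.le] at h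
  exact h.congr_fun (fun s hs => (resolventKernel_eq hγ lam hs.1).symm) measurableSet_Ioc

theorem locallyIntegrableOn_resolventKernel {γ : ℝ} (hγ : 0 < γ) (lam : ℝ) :
    LocallyIntegrableOn (resolventKernel γ lam) (Ici 0) := by
  intro x hx
  have hx' : (0 : ℝ) < x + 1 := add_pos_of_nonneg_of_pos hx one_pos
  refine ⟨Icc 0 (x + 1), ?_, ?_⟩
  · rw [← Ici_inter_Iic]
    exact inter_mem self_mem_nhdsWithin (mem_nhdsWithin_of_mem_nhds (Iic_mem_nhds (by linarith)))
  · rw [integrableOn_Icc_iff_integrableOn_Ioc]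
    exact integrableOn_resolventKernel hγ lam hx'

/-- `r_λ` is locally integrable on `[0,∞)`, is the resolvent of the
kernel `λ t^(γ−1)`, and satisfies `1 − ∫₀ᵗ r_λ(s) ds = E_γ(−λ Γ(γ) t^γ)`. -/
theorem resolventKernel_properties
    (γ lam : ℝ) (hγ : γ ∈ Set.Ioo (0:ℝ) 1) (hlam : 0 < lam) :
    MeasureTheory.LocallyIntegrableOn (resolventKernel γ lam) (Set.Ici 0) volume ∧
    (∀ t : ℝ, 0 < t →
      resolventKernel γ lam t +
        lam * ∫ s in (0:ℝ)..t, (t - s) ^ (γ - 1) * resolventKernel γ lam s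
      = lam * t ^ (γ - 1)) ∧
    (∀ t : ℝ, 0 < t →
      1 - ∫ s in (0:ℝ)..t, resolventKernel γ lam s
        = mittagLeffler γ (-(lam * Real.Gamma γ) * t ^ γ)) := by
  have hγ0 : 0 < γ := hγ.1
  refine ⟨locallyIntegrableOn_resolventKernel hγ0 lam, fun t ht => ?_, fun t ht => ?_⟩
  · have hint : ∫ s in (0:ℝ)..t, (t - s) ^ (γ - 1) * resolventKernel γ lam s =
        lam * Real.Gamma γ * ∫ s in (0:ℝ)..t, (t - s) ^ (γ - 1) *
          (s ^ (γ - 1) * mittagLefflerTwo γ γ (-(lam * Real.Gamma γ) * s ^ γ)) := by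
      rw [← intervalIntegral.integral_const_mul, intervalIntegral.integral_of_le ht.le,
        intervalIntegral.integral_of_le ht.le]
      refine setIntegral_congr_fun measurableSet_Ioc fun s hs => ?_
      simp only [resolventKernel_eq hγ0 lam hs.1]
      ring
    rw [hint, integral_sub_rpow_mul_mittagLefflerTwo hγ0 hγ0 hγ0 _ ht,
      resolventKernel_eq hγ0 lam ht, mittagLefflerTwo_eq_add hγ0 γ,
      show γ + γ - 1 = (γ - 1) + γ by ring, Real.rpow_add ht]
    have := (Real.Gamma_pos_of_pos hγ0).ne'
    field_simp
    ring
  · have hint : ∫ s in (0:ℝ)..t, resolventKernel γ lam s = lam * Real.Gamma γ *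
        ∫ s in (0:ℝ)..t, s ^ (γ - 1) * mittagLefflerTwo γ γ (-(lam * Real.Gamma γ) * s ^ γ) := by
      rw [← intervalIntegral.integral_const_mul, intervalIntegral.integral_of_le ht.le,
        intervalIntegral.integral_of_le ht.le]
      exact setIntegral_congr_fun measurableSet_Ioc fun s hs => resolventKernel_eq hγ0 lam hs.1
    rw [hint]
    linarith [mul_integral_rpow_mul_mittagLefflerTwo hγ0 (-(lam * Real.Gamma γ)) ht]
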